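/- Let n ≥ 1 be an integer and t > 0. Let G be the gamma distribution with shape n and rate n/t. Then ∫ |s − t| dG(s) = 2 t e^{−n} n^n / n!. -/

import Mathlib

open MeasureTheory ProbabilityTheory

/-- The density of the gamma distribution with natural shape `m + 1`, on the nonnegative reals. -/
lemma gammaPDFReal_succ_of_nonneg (m : ℕ) (r : ℝ) {x : ℝ} (hx : 0 ≤ x) :
    gammaPDFReal ((m + 1 : ℕ) : ℝ) r x
      = r ^ (m + 1) / (Nat.factorial m : ℝ) * x ^ m * Real.exp (-(r * x)) := by
  rw [gammaPDFReal, if_pos hx, Real.rpow_natCast, Nat.cast_add_one, Real.Gamma_nat_eq_factorial,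
    add_sub_cancel_right, Real.rpow_natCast]

/-- Integration against the gamma distribution with natural shape `m + 1`. -/
lemma integral_gammaMeasure_succ (m : ℕ) {r : ℝ} (hr : 0 < r) (f : ℝ → ℝ) :
    ∫ s, f s ∂(gammaMeasure ((m + 1 : ℕ) : ℝ) r)
      = r ^ (m + 1) / (Nat.factorial m : ℝ)
        * ∫ s in Set.Ioi 0, f s * (s ^ m * Real.exp (-(r * s))) := by
  have hm : (0 : ℝ) < ((m + 1 : ℕ) : ℝ) := by positivity
  rw [gammaMeasure, integral_withDensity_eq_integral_toReal_smul
    (by unfold gammaPDF; fun_prop) (ae_of_all _ fun x => by simp [gammaPDF]),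
    ← setIntegral_eq_integral_of_forall_compl_eq_zero (s := Set.Ici 0),
    integral_Ici_eq_integral_Ioi, ← integral_const_mul]
  · refine setIntegral_congr_fun measurableSet_Ioi fun x hx => ?_
    simp only [gammaPDF, smul_eq_mul, ENNReal.toReal_ofReal (gammaPDFReal_nonneg hm hr x)]
    rw [gammaPDFReal_succ_of_nonneg m r (le_of_lt hx)]
    ring
  · intro x hx
    rw [gammaPDF_of_neg (by simpa using hx)]
    simp

lemma hasDerivAt_neg_pow_mul_exp (m : ℕ) (r x : ℝ) :
    HasDerivAt (fun s => -(s ^ (m + 1) * Real.exp (-(r * s))))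
      ((r * x - (m + 1)) * (x ^ m * Real.exp (-(r * x)))) x := by
  have hexp : HasDerivAt (fun s => Real.exp (-(r * s))) (Real.exp (-(r * x)) * -(r * 1)) x :=
    ((hasDerivAt_id x).const_mul r).neg.exp
  refine ((hasDerivAt_pow (m + 1) x).mul hexp).neg.congr_deriv ?_
  push_cast
  ring

lemma tendsto_neg_pow_mul_exp_atTop (k : ℕ) {r : ℝ} (hr : 0 < r) :
    Filter.Tendsto (fun s : ℝ => -(s ^ k * Real.exp (-(r * s)))) Filter.atTop (nhds 0) := by
  have h := (tendsto_rpow_mul_exp_neg_mul_atTop_nhds_zero k r hr).neg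
  simpa using h

/-- The unnormalised mean absolute deviation integral, in scaled form. -/
lemma integral_abs_sub_mul_pow_mul_exp (m : ℕ) {r t : ℝ} (hr : 0 < r) (ht : 0 < t)
    (hrt : r * t = m + 1) :
    ∫ s in Set.Ioi 0, |s - t| * (s ^ m * Real.exp (-(r * s)))
      = 2 / r * (t ^ (m + 1) * Real.exp (-(r * t))) := by
  set F : ℝ → ℝ := fun s => -(s ^ (m + 1) * Real.exp (-(r * s))) with hF
  set g : ℝ → ℝ := fun s => (r * s - (m + 1)) * (s ^ m * Real.exp (-(r * s))) with hg
  have hderiv : ∀ x, HasDerivAt F (g x) x := hasDerivAt_neg_pow_mul_exp m r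
  have hfac : ∀ s, r * s - (m + 1) = r * (s - t) := fun s => by rw [← hrt]; ring
  have hgpos : ∀ x ∈ Set.Ioi t, 0 ≤ g x := fun x (hx : t < x) => by
    have h0 : 0 < x := ht.trans hx
    have h1 : 0 < x - t := sub_pos.2 hx
    simp only [hg, hfac]
    positivity
  have hlim : Filter.Tendsto F Filter.atTop (nhds 0) := tendsto_neg_pow_mul_exp_atTop (m + 1) hr
  have hupper : ∫ s in Set.Ioi t, g s = 0 - F t :=
    integral_Ioi_of_hasDerivAt_of_nonneg' (fun x _ => hderiv x) hgpos hlim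
  have hint : IntegrableOn g (Set.Ioi t) :=
    integrableOn_Ioi_deriv_of_nonneg' (fun x _ => hderiv x) hgpos hlim
  have hgcont : Continuous g := by fun_prop
  have hlower : ∫ s in Set.Ioc 0 t, g s = F t - F 0 := by
    rw [← intervalIntegral.integral_of_le ht.le]
    exact intervalIntegral.integral_eq_sub_of_hasDerivAt (fun x _ => hderiv x)
      (hgcont.intervalIntegrable _ _)
  have hF0 : F 0 = 0 := by simp [hF]
  have hEqUpper : Set.EqOn (fun s => r⁻¹ * g s)
      (fun s => |s - t| * (s ^ m * Real.exp (-(r * s)))) (Set.Ioi t) := fun s (hs : t < s) => by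
    simp only [hg, hfac, abs_of_pos (sub_pos.2 hs)]
    field_simp
  have hEqLower : Set.EqOn (fun s => -r⁻¹ * g s)
      (fun s => |s - t| * (s ^ m * Real.exp (-(r * s)))) (Set.Ioc 0 t) := fun s hs => by
    simp only [hg, hfac, abs_of_nonpos (sub_nonpos.2 hs.2)]
    field_simp
  rw [← Set.Ioc_union_Ioi_eq_Ioi ht.le, setIntegral_union (Set.Ioc_disjoint_Ioi le_rfl)
    measurableSet_Ioi (Continuous.integrableOn_Ioc (by fun_prop))
    (IntegrableOn.congr_fun (hint.const_mul r⁻¹) hEqUpper measurableSet_Ioi),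
    ← setIntegral_congr_fun measurableSet_Ioc hEqLower,
    ← setIntegral_congr_fun measurableSet_Ioi hEqUpper, integral_const_mul, integral_const_mul,
    hupper, hlower, hF0]
  simp only [hF]
  ring

/-- Equation (gamma_2) of the paper: the gamma distribution with shape `n` and rate `n/t`
satisfies `∫ |s − t| dG(s) = 2 t e^{−n} n^n / n!`. -/
theorem gamma_mean_absolute_deviation
    (n : ℕ) (hn : 1 ≤ n) (t : ℝ) (ht : 0 < t) :
    ∫ s, |s - t| ∂(gammaMeasure n ((n : ℝ) / t))
      = 2 * t * Real.exp (-(n : ℝ)) * (n : ℝ) ^ n / (Nat.factorial n : ℝ) := by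
  obtain ⟨m, rfl⟩ := Nat.exists_eq_add_of_le' hn
  have hr : 0 < ((m + 1 : ℕ) : ℝ) / t := by positivity
  have hrt : ((m + 1 : ℕ) : ℝ) / t * t = ((m + 1 : ℕ) : ℝ) := div_mul_cancel₀ _ ht.ne'
  rw [integral_gammaMeasure_succ m hr,
    integral_abs_sub_mul_pow_mul_exp m hr ht (by rw [hrt]; push_cast; rfl), hrt,
    Nat.factorial_succ, div_pow]
  push_cast
  field_simp
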